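/- arXiv:2103.10067 — 3 statements merged into one kernel-verified Lean document; each statement's English description precedes it below -/
import Mathlib

section
/- For every a ∈ ℤ, every l ∈ ℤ≥1, and every sequence 𝔗 = (T₁,…,T_{l−1}) ∈ {L,R}^{l−1}, there exists a unique admissible chain (𝔠ₖ)_{1≤k≤l} of i-boxes whose envelopes satisfy ã₁ = b̃₁ = a and, for 1 ≤ k ≤ l−1, [ãₖ₊₁,b̃ₖ₊₁] = [ãₖ − 1, b̃ₖ] if Tₖ = L and [ãₖ₊₁,b̃ₖ₊₁] = [ãₖ, b̃ₖ + 1] if Tₖ = R. In other words, admissible chains of i-boxes of length l are in bijection with pairs (a,𝔗) ∈ ℤ × {L,R}^{l−1}. -/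
open Set

variable {I : Type*}

/-- Every fiber of `ι` is unbounded above and unbounded below. -/
def FibersUnbounded (ι : ℤ → I) : Prop :=
  ∀ i : I, ∀ n : ℤ, (∃ k, n < k ∧ ι k = i) ∧ (∃ k, k < n ∧ ι k = i)

/-- `s⁺ = min {t | s < t, ι t = ι s}`. -/
noncomputable def splus (ι : ℤ → I) (s : ℤ) : ℤ := sInf {t : ℤ | s < t ∧ ι t = ι s}

/-- `s⁻ = max {t | t < s, ι t = ι s}`. -/
noncomputable def sminus (ι : ℤ → I) (s : ℤ) : ℤ := sSup {t : ℤ | t < s ∧ ι t = ι s}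

/-- `s(j)⁺ = min {t | s ≤ t, ι t = j}`. -/
noncomputable def jplus (ι : ℤ → I) (s : ℤ) (j : I) : ℤ := sInf {t : ℤ | s ≤ t ∧ ι t = j}

/-- `s(j)⁻ = max {t | t ≤ s, ι t = j}`. -/
noncomputable def jminus (ι : ℤ → I) (s : ℤ) (j : I) : ℤ := sSup {t : ℤ | t ≤ s ∧ ι t = j}

/-- `[a,b]` is an i-box: `a ≤ b` and `ι a = ι b`. -/
def IsIBox (ι : ℤ → I) (a b : ℤ) : Prop := a ≤ b ∧ ι a = ι b

/-- Two i-boxes `[a₁,b₁]` and `[a₂,b₂]` commute. -/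
def BoxCommute (ι : ℤ → I) (a₁ b₁ a₂ b₂ : ℤ) : Prop :=
  (sminus ι a₁ < a₂ ∧ a₂ ≤ b₂ ∧ b₂ < splus ι b₁) ∨
  (sminus ι a₂ < a₁ ∧ a₁ ≤ b₁ ∧ b₁ < splus ι b₂)

/-- The envelope set `𝔠̃ₖ = ⋃_{1 ≤ j ≤ k} [aⱼ,bⱼ]` of the first `k` boxes of a chain. -/
def envSet (a b : ℕ → ℤ) (k : ℕ) : Set ℤ := ⋃ j ∈ Set.Icc 1 k, Set.Icc (a j) (b j)

/-- `ãₖ`, the left endpoint of the envelope. -/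
noncomputable def envA (a b : ℕ → ℤ) (k : ℕ) : ℤ := sInf (envSet a b k)

/-- `b̃ₖ`, the right endpoint of the envelope. -/
noncomputable def envB (a b : ℕ → ℤ) (k : ℕ) : ℤ := sSup (envSet a b k)

/-- A chain of i-boxes `(𝔠ₖ = [a k, b k])_{1 ≤ k ≤ l}`, `l ∈ ℤ≥1 ∪ {∞}`, is admissible if
for every finite `k ≤ l` the envelope is an interval `[ãₖ, b̃ₖ]` with exactly `k` elements and
`𝔠ₖ = [ãₖ,b̃ₖ}` or `𝔠ₖ = {ãₖ,b̃ₖ]`. -/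
def IsAdmissibleChain (ι : ℤ → I) (l : ℕ∞) (a b : ℕ → ℤ) : Prop :=
  ∀ k : ℕ, 1 ≤ k → (k : ℕ∞) ≤ l →
    IsIBox ι (a k) (b k) ∧
    envSet a b k = Set.Icc (envA a b k) (envB a b k) ∧
    envB a b k + 1 = envA a b k + (k : ℤ) ∧
    ((a k = envA a b k ∧ b k = jminus ι (envB a b k) (ι (envA a b k))) ∨
     (a k = jplus ι (envA a b k) (ι (envB a b k)) ∧ b k = envB a b k))

/-- The range `⋃_{1 ≤ k ≤ l} 𝔠ₖ` of a chain. -/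
def chainRange (l : ℕ∞) (a b : ℕ → ℤ) : Set ℤ :=
  ⋃ k ∈ {k : ℕ | 1 ≤ k ∧ (k : ℕ∞) ≤ l}, Set.Icc (a k) (b k)

/-- A chain `(a,b)` of length `l` realizes the pair `(a0, T)` (`T k = false` means `L`,
`T k = true` means `R`): it is admissible with the envelopes prescribed by `(a0, T)`. -/
def MatchesPair (ι : ℤ → I) (l : ℕ) (a0 : ℤ) (T : ℕ → Bool) (a b : ℕ → ℤ) : Prop :=
  IsAdmissibleChain ι (l : ℕ∞) a b ∧
  envA a b 1 = a0 ∧ envB a b 1 = a0 ∧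
  ∀ k : ℕ, 1 ≤ k → k < l →
    (T k = false → envA a b (k + 1) = envA a b k - 1 ∧ envB a b (k + 1) = envB a b k) ∧
    (T k = true → envA a b (k + 1) = envA a b k ∧ envB a b (k + 1) = envB a b k + 1)

theorem jminus_spec (ι : ℤ → I) {s t : ℤ} (h : s ≤ t) :
    s ≤ jminus ι t (ι s) ∧ jminus ι t (ι s) ≤ t ∧ ι (jminus ι t (ι s)) = ι s := by
  have hb : BddAbove {r : ℤ | r ≤ t ∧ ι r = ι s} := ⟨t, fun _ hr => hr.1⟩
  have hs : s ∈ {r : ℤ | r ≤ t ∧ ι r = ι s} := ⟨h, rfl⟩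
  have hm := Int.csSup_mem ⟨s, hs⟩ hb
  exact ⟨le_csSup hb hs, hm.1, hm.2⟩

theorem jplus_spec (ι : ℤ → I) {s t : ℤ} (h : s ≤ t) :
    s ≤ jplus ι s (ι t) ∧ jplus ι s (ι t) ≤ t ∧ ι (jplus ι s (ι t)) = ι t := by
  have hb : BddBelow {r : ℤ | s ≤ r ∧ ι r = ι t} := ⟨s, fun _ hr => hr.1⟩
  have ht : t ∈ {r : ℤ | s ≤ r ∧ ι r = ι t} := ⟨h, rfl⟩
  have hm := Int.csInf_mem ⟨t, ht⟩ hb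
  exact ⟨hm.1, csInf_le hb ht, hm.2⟩

theorem jminus_eq_self {ι : ℤ → I} {s t : ℤ} (h : ι s = ι t) : jminus ι t (ι s) = t := by
  have := jminus_spec ι (le_refl t)
  rw [h]
  omega

theorem jplus_eq_self {ι : ℤ → I} {s t : ℤ} (h : ι s = ι t) : jplus ι s (ι t) = s := by
  have := jplus_spec ι (le_refl s)
  rw [← h]
  omega

theorem envSet_one (a b : ℕ → ℤ) : envSet a b 1 = Set.Icc (a 1) (b 1) := by
  simp [envSet]

theorem envSet_succ (a b : ℕ → ℤ) (k : ℕ) :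
    envSet a b (k + 1) = envSet a b k ∪ Set.Icc (a (k + 1)) (b (k + 1)) := by
  ext x
  simp only [envSet, Set.mem_iUnion, Set.mem_union, exists_prop]
  constructor
  · rintro ⟨j, hj, hx⟩
    rcases eq_or_ne j (k + 1) with rfl | hne
    · exact Or.inr hx
    · exact Or.inl ⟨j, ⟨hj.1, by have := hj.2; omega⟩, hx⟩
  · rintro (⟨j, hj, hx⟩ | hx)
    · exact ⟨j, ⟨hj.1, hj.2.trans k.le_succ⟩, hx⟩
    · exact ⟨k + 1, ⟨k.succ_pos, le_rfl⟩, hx⟩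

section Admissible

variable {ι : ℤ → I} {l : ℕ} {a b : ℕ → ℤ}

theorem IsAdmissibleChain.box_one (h : IsAdmissibleChain ι (l : ℕ∞) a b) (hl : 1 ≤ l) :
    a 1 = envA a b 1 ∧ b 1 = envA a b 1 ∧ envB a b 1 = envA a b 1 := by
  obtain ⟨hi, hE, hc, -⟩ := h 1 le_rfl (by exact_mod_cast hl)
  rw [envSet_one] at hE
  have ha : a 1 ∈ Set.Icc (a 1) (b 1) := ⟨le_rfl, hi.1⟩
  have hb : b 1 ∈ Set.Icc (a 1) (b 1) := ⟨hi.1, le_rfl⟩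
  rw [hE] at ha hb
  obtain ⟨h1, h2⟩ := ha
  obtain ⟨h3, h4⟩ := hb
  push_cast at hc
  omega

/-- Passing to the next envelope adds one integer on the left or on the right, and the new box
is the one issued from that integer. -/
theorem IsAdmissibleChain.step (h : IsAdmissibleChain ι (l : ℕ∞) a b) {k : ℕ} (hk : 1 ≤ k)
    (hkl : k < l) :
    (envA a b (k + 1) = envA a b k - 1 ∧ envB a b (k + 1) = envB a b k ∧
      a (k + 1) = envA a b (k + 1) ∧
      b (k + 1) = jminus ι (envB a b (k + 1)) (ι (envA a b (k + 1)))) ∨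
    (envA a b (k + 1) = envA a b k ∧ envB a b (k + 1) = envB a b k + 1 ∧
      a (k + 1) = jplus ι (envA a b (k + 1)) (ι (envB a b (k + 1))) ∧
      b (k + 1) = envB a b (k + 1)) := by
  obtain ⟨-, hE, hc, -⟩ := h k hk (by exact_mod_cast hkl.le)
  obtain ⟨hi', hE', hc', hbox⟩ := h (k + 1) (by omega) (by exact_mod_cast hkl)
  rw [envSet_succ, hE] at hE'
  have hmem (x : ℤ) := Set.ext_iff.mp hE' x
  simp only [Set.mem_union, Set.mem_Icc] at hmem
  have h1 := hmem (envA a b k)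
  have h2 := hmem (envB a b k)
  have h3 := hmem (envA a b (k + 1))
  have h4 := hmem (envB a b (k + 1))
  have h5 := hmem (a (k + 1))
  have h6 := hmem (b (k + 1))
  have h7 := hi'.1
  push_cast at hc'
  have hs : (envA a b (k + 1) = envA a b k - 1 ∧ envB a b (k + 1) = envB a b k) ∨
      (envA a b (k + 1) = envA a b k ∧ envB a b (k + 1) = envB a b k + 1) := by omega
  rcases hs with ⟨hA, hB⟩ | ⟨hA, hB⟩
  · refine Or.inl ⟨hA, hB, ?_⟩
    have ha : a (k + 1) = envA a b (k + 1) := by omega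
    refine ⟨ha, ?_⟩
    rcases hbox with hbox | hbox
    · exact hbox.2
    · rw [jminus_eq_self, hbox.2]
      rw [← ha, hi'.2, hbox.2]
  · refine Or.inr ⟨hA, hB, ?_⟩
    have hb : b (k + 1) = envB a b (k + 1) := by omega
    refine ⟨?_, hb⟩
    rcases hbox with hbox | hbox
    · rw [jplus_eq_self, hbox.1]
      rw [← hb, ← hi'.2, hbox.1]
    · exact hbox.1

theorem IsAdmissibleChain.exists_matchesPair (h : IsAdmissibleChain ι (l : ℕ∞) a b)
    (hl : 1 ≤ l) : ∃ (a0 : ℤ) (T : ℕ → Bool), MatchesPair ι l a0 T a b := by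
  refine ⟨envA a b 1, fun k => decide (envA a b (k + 1) = envA a b k), h, rfl,
    (h.box_one hl).2.2, fun k hk hkl => ?_⟩
  simp only [decide_eq_false_iff_not, decide_eq_true_eq]
  have := h.step hk hkl
  omega

end Admissible

theorem MatchesPair.unique {ι : ℤ → I} {l : ℕ} {a0 : ℤ} {T : ℕ → Bool} {a b a' b' : ℕ → ℤ}
    (h : MatchesPair ι l a0 T a b) (h' : MatchesPair ι l a0 T a' b') (k : ℕ) (hk : 1 ≤ k)
    (hkl : k ≤ l) : a k = a' k ∧ b k = b' k := by
  obtain ⟨had, hA, hB, hT⟩ := h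
  obtain ⟨had', hA', hB', hT'⟩ := h'
  have henv (k : ℕ) (hk : 1 ≤ k) (hkl : k ≤ l) :
      envA a b k = envA a' b' k ∧ envB a b k = envB a' b' k := by
    induction k, hk using Nat.le_induction with
    | base => omega
    | succ k hk ih =>
      have := ih (by omega)
      have h1 := hT k hk (by omega)
      have h2 := hT' k hk (by omega)
      cases hTk : T k <;> simp only [hTk, forall_const, reduceCtorEq, false_imp_iff, true_and,
        and_true] at h1 h2 <;> omega
  induction k, hk using Nat.le_induction with
  | base =>
    have h1 := had.box_one hkl
    have h2 := had'.box_one hkl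
    omega
  | succ k hk _ =>
    have e1 := henv k hk (by omega)
    have e2 := henv (k + 1) (by omega) hkl
    have h1 := had.step hk (by omega)
    have h2 := had'.step hk (by omega)
    rw [← e1.1, ← e1.2, ← e2.1, ← e2.2] at h2
    omega

/-- The left endpoint of the `k`-th envelope prescribed by `(a0, T)`. -/
def leftEnd (a0 : ℤ) (T : ℕ → Bool) : ℕ → ℤ
  | 0 => a0
  | 1 => a0
  | k + 2 => if T (k + 1) then leftEnd a0 T (k + 1) else leftEnd a0 T (k + 1) - 1

/-- The right endpoint of the `k`-th envelope prescribed by `(a0, T)`. -/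
def rightEnd (a0 : ℤ) (T : ℕ → Bool) (k : ℕ) : ℤ := leftEnd a0 T k + k - 1

/-- The left endpoint of the `k`-th box of the chain built from `(a0, T)`. -/
noncomputable def boxLeft (ι : ℤ → I) (a0 : ℤ) (T : ℕ → Bool) (k : ℕ) : ℤ :=
  if T (k - 1) then jplus ι (leftEnd a0 T k) (ι (rightEnd a0 T k)) else leftEnd a0 T k

/-- The right endpoint of the `k`-th box of the chain built from `(a0, T)`. -/
noncomputable def boxRight (ι : ℤ → I) (a0 : ℤ) (T : ℕ → Bool) (k : ℕ) : ℤ :=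
  if T (k - 1) then rightEnd a0 T k else jminus ι (rightEnd a0 T k) (ι (leftEnd a0 T k))

section Construction

variable (ι : ℤ → I) (a0 : ℤ) (T : ℕ → Bool)

theorem leftEnd_succ {k : ℕ} (hk : 1 ≤ k) :
    leftEnd a0 T (k + 1) = if T k then leftEnd a0 T k else leftEnd a0 T k - 1 := by
  obtain ⟨m, rfl⟩ := Nat.exists_eq_add_of_le' hk
  rfl

theorem leftEnd_le_rightEnd {k : ℕ} (hk : 1 ≤ k) : leftEnd a0 T k ≤ rightEnd a0 T k := by
  unfold rightEnd
  omega

theorem envSet_box {k : ℕ} (hk : 1 ≤ k) :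
    envSet (boxLeft ι a0 T) (boxRight ι a0 T) k =
      Set.Icc (leftEnd a0 T k) (rightEnd a0 T k) := by
  induction k, hk using Nat.le_induction with
  | base =>
    have h1 : rightEnd a0 T 1 = leftEnd a0 T 1 := by simp [rightEnd]
    rw [envSet_one, boxLeft, boxRight, h1, jplus_eq_self rfl, jminus_eq_self rfl]
    simp
  | succ k hk ih =>
    have hle := leftEnd_le_rightEnd a0 T (k := k + 1) (by omega)
    have hl := leftEnd_succ a0 T hk
    have hm := jminus_spec ι hle
    have hp := jplus_spec ι hle
    have hr : rightEnd a0 T (k + 1) = leftEnd a0 T (k + 1) + k := by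
      simp only [rightEnd]
      push_cast
      ring
    have hr' : rightEnd a0 T k = leftEnd a0 T k + k - 1 := rfl
    rw [envSet_succ, ih]
    ext x
    simp only [Set.mem_union, Set.mem_Icc, boxLeft, boxRight, Nat.add_sub_cancel]
    cases hT : T k <;> simp only [hT, if_true, Bool.false_eq_true, if_false] at hl ⊢ <;> omega

theorem envA_box {k : ℕ} (hk : 1 ≤ k) :
    envA (boxLeft ι a0 T) (boxRight ι a0 T) k = leftEnd a0 T k := by
  rw [envA, envSet_box ι a0 T hk, csInf_Icc (leftEnd_le_rightEnd a0 T hk)]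

theorem envB_box {k : ℕ} (hk : 1 ≤ k) :
    envB (boxLeft ι a0 T) (boxRight ι a0 T) k = rightEnd a0 T k := by
  rw [envB, envSet_box ι a0 T hk, csSup_Icc (leftEnd_le_rightEnd a0 T hk)]

theorem matchesPair_box (l : ℕ) :
    MatchesPair ι l a0 T (boxLeft ι a0 T) (boxRight ι a0 T) := by
  refine ⟨fun k hk _ => ?_, ?_, ?_, fun k hk _ => ?_⟩
  · have hle := leftEnd_le_rightEnd a0 T hk
    have hm := jminus_spec ι hle
    have hp := jplus_spec ι hle
    rw [envA_box ι a0 T hk, envB_box ι a0 T hk]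
    refine ⟨?_, envSet_box ι a0 T hk, by simp [rightEnd], ?_⟩
    · unfold IsIBox boxLeft boxRight
      split_ifs
      · exact hp.2
      · exact ⟨hm.1, hm.2.2.symm⟩
    · unfold boxLeft boxRight
      split_ifs <;> simp
  · rw [envA_box ι a0 T le_rfl, leftEnd]
  · simp [envB_box ι a0 T le_rfl, rightEnd, leftEnd]
  · rw [envA_box ι a0 T hk, envB_box ι a0 T hk, envA_box ι a0 T (by omega),
      envB_box ι a0 T (by omega)]
    simp only [rightEnd, leftEnd_succ a0 T hk]
    push_cast
    constructor <;> intro hT <;> simp only [hT, if_true, Bool.false_eq_true, if_false, true_and] <;>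
      ring

end Construction

theorem stmt4 (ι : ℤ → I) (hub : FibersUnbounded ι)
    (a0 : ℤ) (l : ℕ) (hl : 1 ≤ l) (T : ℕ → Bool) :
    (∃ a b : ℕ → ℤ, MatchesPair ι l a0 T a b) ∧
    (∀ a b a' b' : ℕ → ℤ, MatchesPair ι l a0 T a b → MatchesPair ι l a0 T a' b' →
      ∀ k : ℕ, 1 ≤ k → k ≤ l → a k = a' k ∧ b k = b' k) ∧
    (∀ a b : ℕ → ℤ, IsAdmissibleChain ι (l : ℕ∞) a b →
      ∃ (a0' : ℤ) (T' : ℕ → Bool), MatchesPair ι l a0' T' a b) :=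
  ⟨⟨_, _, matchesPair_box ι a0 T l⟩, fun _ _ _ _ h h' => h.unique h',
    fun _ _ h => h.exists_matchesPair hl⟩
end

section
/- (i) For each fixed finite length l, T-equivalence is an equivalence relation on the set of admissible chains of i-boxes of length l. (ii) If two admissible chains are T-equivalent, then they have the same range. (iii) Conversely, any two admissible chains of i-boxes with the same finite range are T-equivalent. -/
open Set

variable {I : Type*}

/-- `ãₖ` of the chain encoded by the pair `(a0, T)` (`T j = false` means `L`, `true` means `R`). -/
def eA (a0 : ℤ) (T : ℕ → Bool) (k : ℕ) : ℤ :=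
  a0 - ((Finset.Ico 1 k).filter (fun j => T j = false)).card

/-- `b̃ₖ` of the chain encoded by the pair `(a0, T)`. -/
def eB (a0 : ℤ) (T : ℕ → Bool) (k : ℕ) : ℤ :=
  a0 + ((Finset.Ico 1 k).filter (fun j => T j = true)).card

/-- Left endpoint `aₖ` of the `k`-th box of the admissible chain encoded by `(a0, T)`:
`𝔠ₖ = {ãₖ,b̃ₖ]` if `Tₖ₋₁ = R`, and `𝔠ₖ = [ãₖ,b̃ₖ}` if `k = 1` or `Tₖ₋₁ = L`. -/
noncomputable def chA (ι : ℤ → I) (a0 : ℤ) (T : ℕ → Bool) (k : ℕ) : ℤ :=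
  if 2 ≤ k ∧ T (k - 1) = true then jplus ι (eA a0 T k) (ι (eB a0 T k)) else eA a0 T k

/-- Right endpoint `bₖ` of the `k`-th box of the admissible chain encoded by `(a0, T)`. -/
noncomputable def chB (ι : ℤ → I) (a0 : ℤ) (T : ℕ → Bool) (k : ℕ) : ℤ :=
  if 2 ≤ k ∧ T (k - 1) = true then eB a0 T k else jminus ι (eB a0 T k) (ι (eA a0 T k))

/-- `𝔠ₛ` is a movable box of the chain of length `l` encoded by `(a0, T)`. -/
def Movable (l : ℕ) (T : ℕ → Bool) (s : ℕ) : Prop :=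
  1 ≤ s ∧ s < l ∧ (s = 1 ∨ T (s - 1) ≠ T s)

/-- The new value `a′` after the box move at `s`. -/
def moveA (a0 : ℤ) (T : ℕ → Bool) (s : ℕ) : ℤ :=
  if s = 1 then (if T 1 = true then a0 + 1 else a0 - 1) else a0

/-- The new sequence `𝔗′` after the box move at `s` (flipping `T` at `s-1` and `s`;
when `s = 1`, flipping the irrelevant index `0` is harmless). -/
def moveT (T : ℕ → Bool) (s : ℕ) : ℕ → Bool :=
  fun k => if k = s - 1 ∨ k = s then !(T k) else T k

/-- The admissible chain of length `l` encoded by the pair `(a0, T)`, recorded as a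
function `ℕ → ℤ × ℤ` (with value `(0,0)` outside `[1,l]`, so that a chain of length `l`
is exactly determined by its boxes `𝔠₁, …, 𝔠_l`). -/
noncomputable def ChainFun (ι : ℤ → I) (l : ℕ) (a0 : ℤ) (T : ℕ → Bool) : ℕ → ℤ × ℤ :=
  fun k => if 1 ≤ k ∧ k ≤ l then (chA ι a0 T k, chB ι a0 T k) else (0, 0)

/-- `c` is an admissible chain of i-boxes of length `l`. -/
def IsChainFun (ι : ℤ → I) (l : ℕ) (c : ℕ → ℤ × ℤ) : Prop :=
  ∃ (a0 : ℤ) (T : ℕ → Bool), c = ChainFun ι l a0 T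

/-- `c'` is obtained from `c` by a single box move. -/
def IsBoxMove (ι : ℤ → I) (l : ℕ) (c c' : ℕ → ℤ × ℤ) : Prop :=
  ∃ (a0 : ℤ) (T : ℕ → Bool) (s : ℕ), Movable l T s ∧
    c = ChainFun ι l a0 T ∧ c' = ChainFun ι l (moveA a0 T s) (moveT T s)

/-- T-equivalence: a finite (possibly empty) sequence of box moves. -/
def TEquiv (ι : ℤ → I) (l : ℕ) : (ℕ → ℤ × ℤ) → (ℕ → ℤ × ℤ) → Prop :=
  Relation.ReflTransGen (IsBoxMove ι l)

/-- The range `⋃_{1 ≤ k ≤ l} 𝔠ₖ` of a chain of length `l`. -/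
def rangeFun (l : ℕ) (c : ℕ → ℤ × ℤ) : Set ℤ :=
  ⋃ k ∈ Set.Icc 1 l, Set.Icc (c k).1 (c k).2

theorem eA_succ (a0 : ℤ) (T : ℕ → Bool) {k : ℕ} (hk : 1 ≤ k) :
    eA a0 T (k + 1) = eA a0 T k - if T k = true then 0 else 1 := by
  unfold eA
  rw [Finset.Ico_add_one_right_eq_Icc, ← Finset.Ico_insert_right hk, Finset.filter_insert]
  by_cases h : T k = true
  · simp [h]
  · simp [h]
    ring

theorem eB_succ (a0 : ℤ) (T : ℕ → Bool) {k : ℕ} (hk : 1 ≤ k) :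
    eB a0 T (k + 1) = eB a0 T k + if T k = true then 1 else 0 := by
  unfold eB
  rw [Finset.Ico_add_one_right_eq_Icc, ← Finset.Ico_insert_right hk, Finset.filter_insert]
  by_cases h : T k = true
  · simp [h]
    ring
  · simp [h]

@[simp] theorem eA_one (a0 : ℤ) (T : ℕ → Bool) : eA a0 T 1 = a0 := by simp [eA]

@[simp] theorem eB_one (a0 : ℤ) (T : ℕ → Bool) : eB a0 T 1 = a0 := by simp [eB]

theorem eA_le_eB (a0 : ℤ) (T : ℕ → Bool) (k : ℕ) : eA a0 T k ≤ eB a0 T k := by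
  unfold eA eB
  omega

theorem eA_congr (a0 : ℤ) {T T' : ℕ → Bool} {k : ℕ} (h : ∀ j, 1 ≤ j → j < k → T j = T' j) :
    eA a0 T k = eA a0 T' k := by
  unfold eA
  congr 3
  refine Finset.filter_congr fun j hj => ?_
  rw [Finset.mem_Ico] at hj
  rw [h j hj.1 hj.2]

theorem eB_congr (a0 : ℤ) {T T' : ℕ → Bool} {k : ℕ} (h : ∀ j, 1 ≤ j → j < k → T j = T' j) :
    eB a0 T k = eB a0 T' k := by
  unfold eB
  congr 3
  refine Finset.filter_congr fun j hj => ?_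
  rw [Finset.mem_Ico] at hj
  rw [h j hj.1 hj.2]

/-- A chain of length `l` only depends on the entries `T₁, …, T_{l-1}`. -/
theorem ChainFun_congr (ι : ℤ → I) (l : ℕ) (a0 : ℤ) {T T' : ℕ → Bool}
    (h : ∀ j, 1 ≤ j → j < l → T j = T' j) : ChainFun ι l a0 T = ChainFun ι l a0 T' := by
  funext k
  unfold ChainFun
  split_ifs with hk
  · have hA : eA a0 T k = eA a0 T' k := eA_congr a0 fun j h1 h2 => h j h1 (by omega)
    have hB : eB a0 T k = eB a0 T' k := eB_congr a0 fun j h1 h2 => h j h1 (by omega)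
    have hT : (2 ≤ k ∧ T (k - 1) = true) ↔ (2 ≤ k ∧ T' (k - 1) = true) :=
      and_congr_right fun h2 => by rw [h (k - 1) (by omega) (by omega)]
    simp only [chA, chB, hA, hB, hT]
  · rfl

theorem le_jplus (ι : ℤ → I) {a b : ℤ} (hab : a ≤ b) : a ≤ jplus ι a (ι b) :=
  le_csInf ⟨b, hab, rfl⟩ fun _ ht => ht.1

theorem jplus_le (ι : ℤ → I) {a b : ℤ} (hab : a ≤ b) : jplus ι a (ι b) ≤ b :=
  csInf_le ⟨a, fun _ ht => ht.1⟩ ⟨hab, rfl⟩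

theorem jminus_le (ι : ℤ → I) {a b : ℤ} (hab : a ≤ b) : jminus ι b (ι a) ≤ b :=
  csSup_le ⟨a, hab, rfl⟩ fun _ ht => ht.1

theorem le_jminus (ι : ℤ → I) {a b : ℤ} (hab : a ≤ b) : a ≤ jminus ι b (ι a) :=
  le_csSup ⟨b, fun _ ht => ht.1⟩ ⟨hab, rfl⟩

/-- The boxes `𝔠₁, …, 𝔠ₖ` cover exactly the envelope `[ãₖ, b̃ₖ]`. -/
theorem exists_mem_box_iff (ι : ℤ → I) (a0 : ℤ) (T : ℕ → Bool) {k : ℕ} (hk : 1 ≤ k) (x : ℤ) :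
    (∃ j, (1 ≤ j ∧ j ≤ k) ∧ chA ι a0 T j ≤ x ∧ x ≤ chB ι a0 T j) ↔
      eA a0 T k ≤ x ∧ x ≤ eB a0 T k := by
  induction k, hk using Nat.le_induction with
  | base =>
    have h1 := jminus_le ι (le_refl a0)
    have h2 := le_jminus ι (le_refl a0)
    constructor
    · rintro ⟨j, hj, hx⟩
      obtain rfl : j = 1 := by omega
      simp [chA, chB] at hx ⊢
      omega
    · intro hx
      refine ⟨1, by omega, ?_⟩
      simp [chA, chB] at hx ⊢
      omega
  | succ k hk ih =>
    have hsplit : (∃ j, (1 ≤ j ∧ j ≤ k + 1) ∧ chA ι a0 T j ≤ x ∧ x ≤ chB ι a0 T j) ↔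
        (∃ j, (1 ≤ j ∧ j ≤ k) ∧ chA ι a0 T j ≤ x ∧ x ≤ chB ι a0 T j) ∨
          (chA ι a0 T (k + 1) ≤ x ∧ x ≤ chB ι a0 T (k + 1)) := by
      constructor
      · rintro ⟨j, hj, hx⟩
        rcases Nat.lt_or_ge k j with h | h
        · obtain rfl : j = k + 1 := by omega
          exact Or.inr hx
        · exact Or.inl ⟨j, ⟨hj.1, h⟩, hx⟩
      · rintro (⟨j, hj, hx⟩ | hx)
        · exact ⟨j, by omega, hx⟩
        · exact ⟨k + 1, by omega, hx⟩
    rw [hsplit, ih]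
    have hle := eA_le_eB a0 T (k + 1)
    have hle' := eA_le_eB a0 T k
    have hA := eA_succ a0 T hk
    have hB := eB_succ a0 T hk
    have h1 := le_jplus ι hle
    have h2 := jplus_le ι hle
    have h3 := le_jminus ι hle
    have h4 := jminus_le ι hle
    by_cases hT : T k = true
    · have hc : 2 ≤ k + 1 ∧ T (k + 1 - 1) = true := ⟨by omega, hT⟩
      simp only [chA, chB, if_pos hc]
      simp only [if_pos hT] at hA hB
      omega
    · have hc : ¬ (2 ≤ k + 1 ∧ T (k + 1 - 1) = true) := fun h => hT h.2
      simp only [chA, chB, if_neg hc]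
      simp only [if_neg hT] at hA hB
      omega

theorem rangeFun_ChainFun (ι : ℤ → I) {l : ℕ} (hl : 1 ≤ l) (a0 : ℤ) (T : ℕ → Bool) :
    rangeFun l (ChainFun ι l a0 T) = Set.Icc (eA a0 T l) (eB a0 T l) := by
  ext x
  rw [Set.mem_Icc, ← exists_mem_box_iff ι a0 T hl x]
  simp only [rangeFun, Set.mem_iUnion, Set.mem_Icc, exists_prop]
  refine exists_congr fun j => and_congr_right fun hj => ?_
  simp only [ChainFun, if_pos hj]

theorem moveT_moveT (T : ℕ → Bool) (s : ℕ) : moveT (moveT T s) s = T := by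
  funext k
  unfold moveT
  split_ifs <;> simp

theorem moveA_moveA (a0 : ℤ) (T : ℕ → Bool) (s : ℕ) :
    moveA (moveA a0 T s) (moveT T s) s = a0 := by
  unfold moveA
  by_cases hs : s = 1
  · subst hs
    cases h : T 1 <;> simp [moveT, h]
  · simp [hs]

theorem Movable.moveT {l : ℕ} {T : ℕ → Bool} {s : ℕ} (h : Movable l T s) :
    Movable l (moveT T s) s := by
  refine ⟨h.1, h.2.1, h.2.2.imp_right fun hne => ?_⟩
  simpa [_root_.moveT] using hne

theorem IsBoxMove.symm {ι : ℤ → I} {l : ℕ} {c c' : ℕ → ℤ × ℤ} (h : IsBoxMove ι l c c') :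
    IsBoxMove ι l c' c := by
  obtain ⟨a0, T, s, hs, rfl, rfl⟩ := h
  exact ⟨_, _, s, hs.moveT, rfl, by rw [moveT_moveT, moveA_moveA]⟩

theorem TEquiv.symm {ι : ℤ → I} {l : ℕ} {c c' : ℕ → ℤ × ℤ} (h : TEquiv ι l c c') :
    TEquiv ι l c' c :=
  haveI : Std.Symm (IsBoxMove ι l) := ⟨fun _ _ => IsBoxMove.symm⟩
  Std.Symm.symm (r := Relation.ReflTransGen (IsBoxMove ι l)) _ _ h

theorem TEquiv.equivalence (ι : ℤ → I) (l : ℕ) : Equivalence (TEquiv ι l) :=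
  ⟨fun _ => Relation.ReflTransGen.refl, TEquiv.symm, Relation.ReflTransGen.trans⟩

/-- A box move at `s` does not change the envelopes `𝔠̃ₖ` with `k > s`. -/
theorem envelope_move {l : ℕ} (a0 : ℤ) {T : ℕ → Bool} {s : ℕ} (h : Movable l T s) {k : ℕ}
    (hk : s + 1 ≤ k) :
    eA (moveA a0 T s) (moveT T s) k = eA a0 T k ∧
      eB (moveA a0 T s) (moveT T s) k = eB a0 T k := by
  induction k, hk using Nat.le_induction with
  | base =>
    obtain ⟨h1, -, h3⟩ := h
    by_cases hs : s = 1
    · subst hs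
      rw [eA_succ _ _ le_rfl, eB_succ _ _ le_rfl, eA_succ _ _ le_rfl, eB_succ _ _ le_rfl]
      cases hT : T 1 <;> simp [moveT, moveA, hT]
    · obtain ⟨r, rfl⟩ : ∃ r, s = r + 1 := ⟨s - 1, by omega⟩
      have hr : 1 ≤ r := by omega
      have hne : T r ≠ T (r + 1) := h3.resolve_left hs
      have hc : ∀ j, 1 ≤ j → j < r → moveT T (r + 1) j = T j := fun j _ hj => by
        unfold moveT
        rw [if_neg (by omega)]
      have hA := eA_congr a0 hc
      have hB := eB_congr a0 hc
      have hm : moveA a0 T (r + 1) = a0 := if_neg hs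
      rw [hm]
      simp only [eA_succ _ _ h1, eB_succ _ _ h1, eA_succ _ _ hr, eB_succ _ _ hr, hA, hB]
      cases hT : T r <;> cases hT' : T (r + 1) <;> simp_all [moveT]
  | succ k hk ih =>
    have h1 := h.1
    have hT : moveT T s k = T k := if_neg (by omega)
    have hk1 : 1 ≤ k := by omega
    rw [eA_succ _ _ hk1, eB_succ _ _ hk1, eA_succ _ _ hk1, eB_succ _ _ hk1, ih.1, ih.2, hT]
    exact ⟨rfl, rfl⟩

theorem IsBoxMove.rangeFun_eq {ι : ℤ → I} {l : ℕ} {c c' : ℕ → ℤ × ℤ} (h : IsBoxMove ι l c c') :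
    rangeFun l c = rangeFun l c' := by
  obtain ⟨a0, T, s, hs, rfl, rfl⟩ := h
  have hl : 1 ≤ l := hs.1.trans hs.2.1.le
  obtain ⟨hA, hB⟩ := envelope_move a0 hs (k := l) hs.2.1
  rw [rangeFun_ChainFun ι hl, rangeFun_ChainFun ι hl, hA, hB]

theorem TEquiv.rangeFun_eq {ι : ℤ → I} {l : ℕ} {c c' : ℕ → ℤ × ℤ} (h : TEquiv ι l c c') :
    rangeFun l c = rangeFun l c' := by
  induction h with
  | refl => rfl
  | tail _ hstep ih => exact ih.trans hstep.rangeFun_eq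

/-- A first `L` at position `m`, preceded only by `R`s, can be turned into an `R` by box moves,
which shift the starting point one step to the left. -/
theorem TEquiv.of_first_left (ι : ℤ → I) {l m : ℕ} (hm : 1 ≤ m) (hml : m < l) (a0 : ℤ)
    {T T' : ℕ → Bool} (hR : ∀ j, 1 ≤ j → j < m → T j = true) (hL : T m = false)
    (hm' : T' m = true) (hT' : ∀ j, 1 ≤ j → j < l → j ≠ m → T' j = T j) :
    TEquiv ι l (ChainFun ι l a0 T) (ChainFun ι l (a0 - 1) T') := by
  induction m, hm using Nat.le_induction generalizing T with
  | base =>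
    refine Relation.ReflTransGen.single ⟨a0, T, 1, ⟨le_rfl, hml, Or.inl rfl⟩, rfl, ?_⟩
    have hA : moveA a0 T 1 = a0 - 1 := by simp [moveA, hL]
    rw [hA]
    refine ChainFun_congr ι l _ fun j h1 h2 => ?_
    by_cases hj : j = 1
    · subst hj
      simp [moveT, hL, hm']
    · rw [hT' j h1 h2 hj, moveT, if_neg (by omega)]
  | succ m hm ih =>
    have hTm : T m = true := hR m hm (by omega)
    have hA : moveA a0 T (m + 1) = a0 := if_neg (by omega)
    have hmov : Movable l T (m + 1) := ⟨by omega, hml, Or.inr (by simp [hTm, hL])⟩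
    refine Relation.ReflTransGen.head ⟨a0, T, m + 1, hmov, rfl, rfl⟩ ?_
    rw [hA]
    refine ih (by omega) (fun j h1 h2 => ?_) ?_ ?_ fun j h1 h2 h3 => ?_
    · rw [moveT, if_neg (by omega)]
      exact hR j h1 (by omega)
    · simp [moveT, hTm]
    · rw [hT' m hm (by omega) (by omega), hTm]
    · by_cases hj : j = m + 1
      · subst hj
        simp [moveT, hL, hm']
      · rw [hT' j h1 h2 hj, moveT, if_neg (by omega)]

/-- The first `m - 1` entries of `T` can all be turned into `R` by box moves. -/
theorem TEquiv.right_prefix (ι : ℤ → I) {l m : ℕ} (hm : 1 ≤ m) (hml : m ≤ l) (a0 : ℤ)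
    (T : ℕ → Bool) :
    TEquiv ι l (ChainFun ι l a0 T)
      (ChainFun ι l (eA a0 T m) fun j => if j < m then true else T j) := by
  induction m, hm using Nat.le_induction with
  | base =>
    rw [eA_one, ChainFun_congr ι l a0 (T' := fun j => if j < 1 then true else T j)]
    · exact Relation.ReflTransGen.refl
    · intro j h1 _
      rw [if_neg (by omega)]
  | succ m hm ih =>
    refine (ih (by omega)).trans ?_
    rw [eA_succ _ _ hm]
    by_cases hT : T m = true
    · rw [if_pos hT, sub_zero, ChainFun_congr ι l _ (T' := fun j => if j < m + 1 then true else T j)]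
      intro j _ _
      by_cases hj : j = m
      · simp [hj, hT]
      · have : j < m + 1 ↔ j < m := by omega
        simp only [this]
    · rw [if_neg hT]
      refine TEquiv.of_first_left ι hm hml _ (fun j _ hj => if_pos hj) ?_ (by simp)
        fun j _ _ hj => ?_
      · simpa using hT
      · have : j < m + 1 ↔ j < m := by omega
        simp only [this]

/-- Every chain is T-equivalent to the chain growing only to the right with the same range. -/
theorem TEquiv.all_right (ι : ℤ → I) {l : ℕ} (hl : 1 ≤ l) (a0 : ℤ) (T : ℕ → Bool) :
    TEquiv ι l (ChainFun ι l a0 T) (ChainFun ι l (eA a0 T l) fun _ => true) := by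
  have h := TEquiv.right_prefix ι hl le_rfl a0 T
  rwa [ChainFun_congr ι l _ (T' := fun _ => true) fun j _ hj => if_pos hj] at h

theorem TEquiv.of_rangeFun_eq (ι : ℤ → I) {l : ℕ} (hl : 1 ≤ l) {c c' : ℕ → ℤ × ℤ}
    (hc : IsChainFun ι l c) (hc' : IsChainFun ι l c') (h : rangeFun l c = rangeFun l c') :
    TEquiv ι l c c' := by
  obtain ⟨a0, T, rfl⟩ := hc
  obtain ⟨a0', T', rfl⟩ := hc'
  rw [rangeFun_ChainFun ι hl, rangeFun_ChainFun ι hl] at h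
  have hA : eA a0 T l = eA a0' T' l := by
    rw [← csInf_Icc (eA_le_eB a0 T l), h, csInf_Icc (eA_le_eB a0' T' l)]
  have h1 := TEquiv.all_right ι hl a0 T
  rw [hA] at h1
  exact h1.trans (TEquiv.all_right ι hl a0' T').symm

theorem stmt8 (ι : ℤ → I) (hub : FibersUnbounded ι) (l : ℕ) (hl : 1 ≤ l) :
    Equivalence (TEquiv ι l) ∧
    (∀ c c' : ℕ → ℤ × ℤ, TEquiv ι l c c' → rangeFun l c = rangeFun l c') ∧
    (∀ c c' : ℕ → ℤ × ℤ, IsChainFun ι l c → IsChainFun ι l c' →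
      rangeFun l c = rangeFun l c' → TEquiv ι l c c') := by
  exact ⟨TEquiv.equivalence ι l, fun _ _ h => h.rangeFun_eq,
    fun _ _ hc hc' h => TEquiv.of_rangeFun_eq ι hl hc hc' h⟩
end

section
/- Let 𝔠 = (𝔠ₖ)_{1≤k≤l} be an admissible chain of i-boxes, let 1 ≤ k₀ < l be such that 𝔠ₖ₀ is movable, and assume the envelope 𝔠̃ₖ₀₊₁ = [a,b] is an i-box. If a⁺ ≤ b⁻, then the i-box [a⁺,b⁻] is a member of the truncated chain (𝔠ₖ)_{1≤k≤k₀+1}; that is, [a⁺,b⁻] = 𝔠ₛ for some 1 ≤ s ≤ k₀+1. -/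
open Set

variable {I : Type*}

theorem isLeast_splus {ι : ℤ → I} (hub : FibersUnbounded ι) (s : ℤ) :
    IsLeast {t : ℤ | s < t ∧ ι t = ι s} (splus ι s) := by
  have hbdd : BddBelow {t : ℤ | s < t ∧ ι t = ι s} := ⟨s, fun _ ht => ht.1.le⟩
  exact ⟨Int.csInf_mem (hub (ι s) s).1 hbdd, fun _ ht => csInf_le hbdd ht⟩

theorem isGreatest_sminus {ι : ℤ → I} (hub : FibersUnbounded ι) (s : ℤ) :
    IsGreatest {t : ℤ | t < s ∧ ι t = ι s} (sminus ι s) := by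
  have hbdd : BddAbove {t : ℤ | t < s ∧ ι t = ι s} := ⟨s, fun _ ht => ht.1.le⟩
  exact ⟨Int.csSup_mem (hub (ι s) s).2 hbdd, fun _ ht => le_csSup hbdd ht⟩

theorem jplus_le_s9 {ι : ℤ → I} {s t : ℤ} {j : I} (hst : s ≤ t) (ht : ι t = j) :
    jplus ι s j ≤ t :=
  csInf_le ⟨s, fun _ hx => hx.1⟩ ⟨hst, ht⟩

theorem le_jminus_s9 {ι : ℤ → I} {s t : ℤ} {j : I} (hts : t ≤ s) (ht : ι t = j) :
    t ≤ jminus ι s j :=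
  le_csSup ⟨s, fun _ hx => hx.1⟩ ⟨hts, ht⟩

theorem envSet_mono (a b : ℕ → ℤ) : Monotone (envSet a b) := fun _ _ hmn =>
  biUnion_subset_biUnion_left (Icc_subset_Icc_right hmn)

theorem Icc_subset_envSet (a b : ℕ → ℤ) {k : ℕ} (hk : 1 ≤ k) :
    Icc (a k) (b k) ⊆ envSet a b k :=
  subset_biUnion_of_mem (u := fun j => Icc (a j) (b j)) (show k ∈ Icc 1 k from ⟨hk, le_rfl⟩)

theorem mem_envSet_succ {a b : ℕ → ℤ} {k : ℕ} {x : ℤ} (hx : x ∈ envSet a b (k + 1)) :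
    x ∈ envSet a b k ∨ x ∈ Icc (a (k + 1)) (b (k + 1)) := by
  simp only [envSet, mem_iUnion, exists_prop] at hx ⊢
  obtain ⟨j, ⟨hj1, hjk⟩, hj⟩ := hx
  rcases hjk.lt_or_eq with hlt | rfl
  · exact Or.inl ⟨j, ⟨hj1, Nat.lt_succ_iff.mp hlt⟩, hj⟩
  · exact Or.inr hj

namespace IsAdmissibleChain

variable {ι : ℤ → I} {l : ℕ∞} {a b : ℕ → ℤ}

theorem env_nested (h : IsAdmissibleChain ι l a b) {m n : ℕ} (hm : 1 ≤ m) (hmn : m ≤ n)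
    (hn : (n : ℕ∞) ≤ l) : envA a b n ≤ envA a b m ∧ envB a b m ≤ envB a b n := by
  obtain ⟨-, hm_env, hm_card, -⟩ := h m hm ((Nat.cast_le.mpr hmn).trans hn)
  obtain ⟨-, hn_env, -, -⟩ := h n (hm.trans hmn) hn
  have hsub := envSet_mono a b hmn
  rw [hm_env, hn_env] at hsub
  exact (Icc_subset_Icc_iff (by omega)).mp hsub

theorem box_nested (h : IsAdmissibleChain ι l a b) {k : ℕ} (hk : 1 ≤ k) (hkl : (k : ℕ∞) ≤ l) :
    envA a b k ≤ a k ∧ b k ≤ envB a b k := by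
  obtain ⟨⟨hle, -⟩, henv, -, -⟩ := h k hk hkl
  have hsub := Icc_subset_envSet a b hk
  rw [henv] at hsub
  exact (Icc_subset_Icc_iff hle).mp hsub

/-- The point by which the envelope grows lies in the newly added box. -/
theorem mem_box_of_notMem_env (h : IsAdmissibleChain ι l a b) {k : ℕ} (hk : 1 ≤ k)
    (hkl : ((k + 1 : ℕ) : ℕ∞) ≤ l) {x : ℤ}
    (hx : x ∈ Icc (envA a b (k + 1)) (envB a b (k + 1)))
    (hxk : x ∉ Icc (envA a b k) (envB a b k)) : x ∈ Icc (a (k + 1)) (b (k + 1)) := by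
  rw [← (h (k + 1) (by omega) hkl).2.1] at hx
  rw [← (h k hk ((Nat.cast_le.mpr k.le_succ).trans hkl)).2.1] at hxk
  exact (mem_envSet_succ hx).resolve_left hxk

/-- The box of a chain whose envelope is the first one to contain `[p,q]`, where `p` and `q` are
the extreme points of a given color in some later envelope, is `[p,q]`. -/
theorem exists_box_eq (h : IsAdmissibleChain ι l a b) {n : ℕ} (hn : 1 ≤ n) (hnl : (n : ℕ∞) ≤ l)
    {p q : ℤ} (hpq : p ≤ q) (hι : ι p = ι q) (hp : envA a b n ≤ p) (hq : q ≤ envB a b n)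
    (hmin : ∀ t, envA a b n ≤ t → ι t = ι p → p ≤ t)
    (hmax : ∀ t, t ≤ envB a b n → ι t = ι p → t ≤ q) :
    ∃ s, 1 ≤ s ∧ s ≤ n ∧ a s = p ∧ b s = q := by
  classical
  have hex : ∃ s, 1 ≤ s ∧ envA a b s ≤ p ∧ q ≤ envB a b s := ⟨n, hn, hp, hq⟩
  obtain ⟨hs, hsp, hsq⟩ := Nat.find_spec hex
  have hsn : Nat.find hex ≤ n := Nat.find_min' hex ⟨hn, hp, hq⟩
  have hprev := fun m (hm : m < Nat.find hex) => Nat.find_min hex hm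
  generalize Nat.find hex = s at *
  have hsl : (s : ℕ∞) ≤ l := (Nat.cast_le.mpr hsn).trans hnl
  obtain ⟨hA, hB⟩ := h.env_nested hs hsn hnl
  obtain ⟨ha, hb⟩ := h.box_nested hs hsl
  obtain ⟨⟨hab, hιab⟩, -, hcard, hbox⟩ := h s hs hsl
  have hcase : (envA a b s = p ∧ a s = p) ∨ (envB a b s = q ∧ b s = q) := by
    obtain rfl | ⟨m, hm, rfl⟩ : s = 1 ∨ ∃ m, 1 ≤ m ∧ s = m + 1 := by
      rcases hs.eq_or_lt with h1 | h1
      · exact Or.inl h1.symm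
      · exact Or.inr ⟨s - 1, by omega, by omega⟩
    · left; constructor <;> push_cast at hcard <;> omega
    · have hml : (m : ℕ∞) ≤ l := (Nat.cast_le.mpr m.le_succ).trans hsl
      obtain ⟨hA', hB'⟩ := h.env_nested hm m.le_succ hsl
      have hcard' := (h m hm hml).2.2.1
      push_cast at hcard
      by_cases hpA : p < envA a b m
      · have := h.mem_box_of_notMem_env hm hsl ⟨hsp, hpq.trans hsq⟩ fun hx => hpA.not_ge hx.1
        left; constructor <;> linarith [this.1]
      · have hqB : envB a b m < q := by
          by_contra hqB
          exact hprev m m.lt_succ_self ⟨hm, not_lt.mp hpA, not_lt.mp hqB⟩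
        have := h.mem_box_of_notMem_env hm hsl ⟨hsp.trans hpq, hsq⟩ fun hx => hqB.not_ge hx.2
        right; constructor <;> linarith [this.2]
  refine ⟨s, hs, hsn, ?_⟩
  rcases hcase with ⟨hAp, hap⟩ | ⟨hBq, hbq⟩
  · have hle : b s ≤ q := hmax _ (hb.trans hB) (by rw [← hιab, hap])
    have hge : q ≤ b s := by
      rcases hbox with ⟨-, hbs⟩ | ⟨-, hbs⟩
      · exact hbs ▸ le_jminus_s9 hsq (by rw [hAp, hι])
      · exact hbs ▸ hsq
    exact ⟨hap, hle.antisymm hge⟩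
  · have hge : p ≤ a s := hmin _ (hA.trans ha) (by rw [hιab, hbq, hι])
    have hle : a s ≤ p := by
      rcases hbox with ⟨has, -⟩ | ⟨has, -⟩
      · exact has ▸ hsp
      · exact has ▸ jplus_le_s9 hsp (by rw [hBq, hι])
    exact ⟨hle.antisymm hge, hbq⟩

end IsAdmissibleChain


theorem stmt9 (ι : ℤ → I) (hub : FibersUnbounded ι)
    (l : ℕ∞) (a b : ℕ → ℤ) (h : IsAdmissibleChain ι l a b)
    (k₀ : ℕ) (hk₀ : 1 ≤ k₀) (hk : ((k₀ + 1 : ℕ) : ℕ∞) ≤ l)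
    -- `𝔠ₖ₀` is movable: `k₀ = 1`, or `Tₖ₀₋₁ ≠ Tₖ₀`, i.e. the envelope both grows to the
    -- left and to the right from step `k₀ - 1` to step `k₀ + 1`
    (hmov : k₀ = 1 ∨ (envA a b (k₀ + 1) = envA a b (k₀ - 1) - 1 ∧
                      envB a b (k₀ + 1) = envB a b (k₀ - 1) + 1))
    -- the envelope `𝔠̃ₖ₀₊₁ = [ãₖ₀₊₁, b̃ₖ₀₊₁]` is an i-box
    (hibox : ι (envA a b (k₀ + 1)) = ι (envB a b (k₀ + 1)))
    (hle : splus ι (envA a b (k₀ + 1)) ≤ sminus ι (envB a b (k₀ + 1))) :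
    ∃ s : ℕ, 1 ≤ s ∧ s ≤ k₀ + 1 ∧
      a s = splus ι (envA a b (k₀ + 1)) ∧ b s = sminus ι (envB a b (k₀ + 1)) := by
  obtain ⟨⟨hp, hιp⟩, hp_min⟩ := isLeast_splus hub (envA a b (k₀ + 1))
  obtain ⟨⟨hq, hιq⟩, hq_max⟩ := isGreatest_sminus hub (envB a b (k₀ + 1))
  obtain rfl | hk₁ : k₀ = 1 ∨ 2 ≤ k₀ := by omega
  · have := (h (1 + 1) (by omega) hk).2.2.1
    omega
  · obtain ⟨hA, hB⟩ := hmov.resolve_left (by omega)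
    have hkl : ((k₀ - 1 : ℕ) : ℕ∞) ≤ l :=
      (Nat.cast_le.mpr (by omega : k₀ - 1 ≤ k₀ + 1)).trans hk
    obtain ⟨s, hs, hsk, has, hbs⟩ := h.exists_box_eq (by omega) hkl hle
      (by rw [hιp, hιq, hibox]) (by omega) (by omega)
      (fun t ht hιt => hp_min ⟨by omega, hιt.trans hιp⟩)
      (fun t ht hιt => hq_max ⟨by omega, hιt.trans (hιp.trans hibox)⟩)
    exact ⟨s, hs, by omega, has, hbs⟩
end
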